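/- For every α ∈ (0,1) there exist a compact set E ⊂ ℝ, a Borel probability measure μ on ℝ with μ(E) = 1, and constants 0 < c ≤ C < ∞ such that: (i) |μ̂(ξ)| ≤ C·|ξ|^{−α/2} for every ξ ∈ ℝ with ξ ≠ 0; and (ii) for every x ∈ E and every r ∈ (0, 1/4), c·(2r)^α / log(1/(2r)) ≤ μ([x−r, x+r]) ≤ C·(2r)^α / log(1/(2r)). -/

import Mathlib

open MeasureTheory

namespace SalemAux

/-- the sign attached to a bit -/
noncomputable def sg (b : Bool) : ℝ := if b then -1 else 1

lemma cosh_avg (x y : ℝ) :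
    Real.cosh (x + y) + Real.cosh (x - y) = 2 * (Real.cosh x * Real.cosh y) := by
  rw [Real.cosh_add, Real.cosh_sub]; ring

lemma signs {ι : Type*} (K : Finset ι) (b : ι → ℕ → ℝ) (hb : ∀ k j, |b k j| ≤ 1) (l : ℝ) (N : ℕ) :
    ∃ ε : ℕ → Bool, ∑ k ∈ K, Real.cosh (l * ∑ j ∈ Finset.range N, sg (ε j) * b k j)
      ≤ K.card * Real.exp (l ^ 2 * N / 2) := by
  induction N with
  | zero => exact ⟨fun _ => true, by simp⟩
  | succ N ih =>
    obtain ⟨ε, hε⟩ := ih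
    set S : ι → ℝ := fun k => ∑ j ∈ Finset.range N, sg (ε j) * b k j with hS
    have key : ∑ k ∈ K, Real.cosh (l * S k + l * b k N) + ∑ k ∈ K, Real.cosh (l * S k - l * b k N)
        ≤ 2 * (K.card * Real.exp (l ^ 2 * (N + 1 : ℕ) / 2)) := by
      rw [← Finset.sum_add_distrib]
      calc _ ≤ ∑ k ∈ K, 2 * (Real.cosh (l * S k) * Real.exp (l ^ 2 / 2)) := by
            apply Finset.sum_le_sum
            intro k _
            rw [cosh_avg]
            have h1 : Real.cosh (l * b k N) ≤ Real.exp (l ^ 2 / 2) := by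
              refine (Real.cosh_le_exp_half_sq _).trans ?_
              apply Real.exp_le_exp.mpr
              have h3 : (b k N) ^ 2 ≤ 1 := by
                rw [← sq_abs]; exact pow_le_one₀ (abs_nonneg _) (hb k N)
              nlinarith [sq_nonneg l]
            have h2 := Real.cosh_pos (l * S k)
            gcongr
        _ = 2 * ((∑ k ∈ K, Real.cosh (l * S k)) * Real.exp (l ^ 2 / 2)) := by
            rw [Finset.sum_mul, Finset.mul_sum]
        _ ≤ 2 * ((K.card * Real.exp (l ^ 2 * N / 2)) * Real.exp (l ^ 2 / 2)) := by gcongr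
        _ = _ := by
            rw [mul_assoc, ← Real.exp_add]; congr 4; push_cast; ring
    have gen : ∀ bit : Bool, ∀ k, ∑ j ∈ Finset.range (N + 1),
        sg ((Function.update ε N bit) j) * b k j = S k + sg bit * b k N := by
      intro bit k
      rw [Finset.sum_range_succ]
      congr 1
      · apply Finset.sum_congr rfl
        intro j hj
        have : j ≠ N := (Finset.mem_range.mp hj).ne
        simp [Function.update_of_ne this]
      · simp
    by_cases h : ∑ k ∈ K, Real.cosh (l * S k + l * b k N)
        ≤ K.card * Real.exp (l ^ 2 * (N + 1 : ℕ) / 2)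
    · refine ⟨Function.update ε N false, ?_⟩
      simp only [gen]
      convert h using 3
      simp [sg]; ring_nf
    · refine ⟨Function.update ε N true, ?_⟩
      simp only [gen]
      have h' : ∑ k ∈ K, Real.cosh (l * S k - l * b k N)
        ≤ K.card * Real.exp (l ^ 2 * (N + 1 : ℕ) / 2) := by linarith
      convert h' using 3
      simp [sg]; ring_nf

lemma signs' {ι : Type*} (K : Finset ι) (b : ι → ℕ → ℝ) (hb : ∀ k j, |b k j| ≤ 1) (L : ℝ)
    (hL : 0 < L) (hK : 2 * (K.card : ℝ) ≤ Real.exp L) (N : ℕ) (hN : 0 < N) :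
    ∃ ε : ℕ → Bool, ∀ k ∈ K, |∑ j ∈ Finset.range N, sg (ε j) * b k j|
      ≤ 3 / 2 * Real.sqrt (N * L) := by
  have hN' : (0 : ℝ) < N := by exact_mod_cast hN
  obtain ⟨ε, hε⟩ := signs K b hb (Real.sqrt (L / N)) N
  refine ⟨ε, fun k hk => ?_⟩
  set S := ∑ j ∈ Finset.range N, sg (ε j) * b k j
  set l := Real.sqrt (L / N) with hl
  have hl0 : 0 < l := Real.sqrt_pos.mpr (by positivity)
  have hl2 : l ^ 2 * N = L := by
    rw [hl, Real.sq_sqrt (by positivity)]; field_simp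
  have h1 : Real.cosh (l * S) ≤ K.card * Real.exp (l ^ 2 * N / 2) := by
    refine le_trans ?_ hε
    exact Finset.single_le_sum (f := fun k => Real.cosh (l * ∑ j ∈ Finset.range N, sg (ε j) * b k j))
      (fun i _ => (Real.cosh_pos _).le) hk
  rw [hl2] at h1
  have h2 : Real.exp |l * S| ≤ Real.exp (L + L / 2) := by
    have h3 : Real.exp |l * S| ≤ 2 * Real.cosh (l * S) := by
      rw [← Real.cosh_abs, Real.cosh_eq]
      have := Real.exp_pos (-|l * S|)
      linarith
    rw [Real.exp_add]
    have := Real.exp_pos (L / 2)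
    nlinarith
  have h3 := Real.exp_le_exp.mp h2
  rw [abs_mul, abs_of_pos hl0] at h3
  have h4 : l * Real.sqrt (N * L) = L := by
    rw [hl, ← Real.sqrt_mul (by positivity)]
    rw [show L / N * (N * L) = L ^ 2 by field_simp]
    exact Real.sqrt_sq hL.le
  have h5 : l * |S| ≤ l * (3 / 2 * Real.sqrt (N * L)) := by
    nlinarith
  exact le_of_mul_le_mul_left h5 hl0

/-- the character -/
noncomputable def ee (x : ℝ) : ℂ := Complex.exp (-(2 * (Real.pi : ℂ) * Complex.I * (x : ℂ)))

lemma ee_eq (x : ℝ) : ee x = Complex.exp (((-(2 * Real.pi * x) : ℝ) : ℂ) * Complex.I) := by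
  unfold ee; congr 1; push_cast; ring

lemma norm_ee (x : ℝ) : ‖ee x‖ = 1 := by
  rw [ee_eq, Complex.norm_exp_ofReal_mul_I]

lemma ee_add (x y : ℝ) : ee (x + y) = ee x * ee y := by
  unfold ee; rw [← Complex.exp_add]; congr 1; push_cast; ring

lemma ee_zero : ee 0 = 1 := by simp [ee]

lemma continuous_ee : Continuous ee := by unfold ee; fun_prop

lemma norm_ee_sub_one (x : ℝ) : ‖ee x - 1‖ ≤ 2 * Real.pi * |x| := by
  rw [ee_eq, mul_comm]
  refine (Real.norm_exp_I_mul_ofReal_sub_one_le (x := -(2 * Real.pi * x))).trans ?_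
  rw [Real.norm_eq_abs, abs_neg, abs_mul, abs_of_pos (by positivity)]

lemma norm_ee_sub (x y : ℝ) : ‖ee x - ee y‖ ≤ 2 * Real.pi * |x - y| := by
  have : ee x - ee y = ee y * (ee (x - y) - 1) := by
    rw [mul_sub, ← ee_add]; simp
  rw [this, norm_mul, norm_ee, one_mul]
  exact norm_ee_sub_one _

lemma step (n N : ℕ) (hN : 0 < N) (v : ℕ → ℕ → ℂ) (hv : ∀ k j, ‖v k j‖ ≤ 1) :
    ∃ ε : ℕ → Bool, ∀ k : ℕ, k ≤ 256 ^ n →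
      ‖∑ j ∈ Finset.range N, (sg (ε j) : ℂ) * v k j‖ ≤ 3 * Real.sqrt (N * (6 * (n + 1))) := by
  let K : Finset (ℕ × Bool) := Finset.range (256 ^ n + 1) ×ˢ Finset.univ
  have hK : 2 * (K.card : ℝ) ≤ Real.exp (6 * (n + 1)) := by
    have h1 : (K.card : ℝ) = (256 ^ n + 1) * 2 := by
      simp [K]
    have h2 : (256 : ℝ) ≤ Real.exp 6 := by
      have := Real.exp_one_gt_d9
      have h3 : Real.exp 6 = Real.exp 1 ^ 6 := by rw [← Real.exp_nat_mul]; norm_num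
      rw [h3]
      calc (256 : ℝ) ≤ 2.7 ^ 6 := by norm_num
        _ ≤ _ := by gcongr; linarith
    have h3 : Real.exp (6 * (n + 1)) = Real.exp 6 ^ (n + 1) := by
      rw [← Real.exp_nat_mul]; congr 1; push_cast; ring
    have h4 : (256 : ℝ) ^ (n + 1) ≤ Real.exp 6 ^ (n + 1) := by gcongr
    have h5 : (1 : ℝ) ≤ 256 ^ n := one_le_pow₀ (by norm_num)
    rw [h1, h3]; rw [pow_succ] at h4; linarith
  obtain ⟨ε, hε⟩ := signs' K (fun p j => if p.2 then (v p.1 j).re else (v p.1 j).im)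
    (by
      intro p j
      split_ifs
      · exact (Complex.abs_re_le_norm _).trans (hv _ _)
      · exact (Complex.abs_im_le_norm _).trans (hv _ _)) _ (by positivity) hK N hN
  refine ⟨ε, fun k hk => ?_⟩
  have h1 := hε (k, true) (by simp [K]; omega)
  have h2 := hε (k, false) (by simp [K]; omega)
  refine (Complex.norm_le_abs_re_add_abs_im _).trans ?_
  simp only [Complex.re_sum, Complex.im_sum, Complex.re_ofReal_mul, Complex.im_ofReal_mul]
  simp only [if_true, Bool.false_eq_true, if_false] at h1 h2
  linarith

lemma exists_data (m : ℕ → ℕ) : ∃ G : ℕ → ℕ → ℕ, G 0 0 = 0 ∧ ∀ n,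
    (m (n + 1) = m n → ∃ ε : ℕ → Bool, (∀ j, G (n + 1) j = 2 * G n j + (ε j).toNat) ∧
      ∀ k : ℕ, k ≤ 256 ^ n → ‖∑ j ∈ Finset.range (2 ^ m n), (sg (ε j) : ℂ) *
        ee (Real.sqrt k * ((G n j : ℝ) / 2 ^ n))‖ ≤ 3 * Real.sqrt (2 ^ m n * (6 * (n + 1)))) ∧
    (m (n + 1) ≠ m n → ∀ j, G (n + 1) j = 2 * G n (j / 2) + j % 2) := by
  have H : ∀ (n : ℕ) (g : ℕ → ℕ), ∃ ε : ℕ → Bool,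
      ∀ k : ℕ, k ≤ 256 ^ n → ‖∑ j ∈ Finset.range (2 ^ m n), (sg (ε j) : ℂ) *
        ee (Real.sqrt k * ((g j : ℝ) / 2 ^ n))‖ ≤ 3 * Real.sqrt (2 ^ m n * (6 * (n + 1))) := by
    intro n g
    obtain ⟨ε, hε⟩ := step n (2 ^ m n) (by positivity)
      (fun k j => ee (Real.sqrt k * ((g j : ℝ) / 2 ^ n))) (fun k j => (norm_ee _).le)
    refine ⟨ε, fun k hk => ?_⟩
    simpa using hε k hk
  choose c hc using H
  let G : ℕ → ℕ → ℕ := fun n => Nat.rec (fun _ => 0) (fun n g =>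
    if m (n + 1) = m n then fun j => 2 * g j + (c n g j).toNat
    else fun j => 2 * g (j / 2) + j % 2) n
  have hG : ∀ n, G (n + 1) = if m (n + 1) = m n then fun j => 2 * G n j + (c n (G n) j).toNat
    else fun j => 2 * G n (j / 2) + j % 2 := fun n => rfl
  refine ⟨G, rfl, fun n => ⟨fun h => ⟨c n (G n), ?_, hc n (G n)⟩, fun h => ?_⟩⟩
  · intro j; rw [hG, if_pos h]
  · intro j; rw [hG, if_neg h]

lemma exists_m (α : ℝ) (hα0 : 0 < α) (hα1 : α < 1) : ∃ (m : ℕ → ℕ) (c₁ c₂ : ℝ), 0 < c₁ ∧ 0 < c₂ ∧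
    m 0 = 0 ∧ (∀ n, m (n + 1) = m n ∨ m (n + 1) = m n + 1) ∧
    ∀ n : ℕ, c₁ * ((2 : ℝ) ^ (α * n) * (n + 1)) ≤ 2 ^ m n ∧
      (2 : ℝ) ^ m n ≤ c₂ * ((2 : ℝ) ^ (α * n) * (n + 1)) := by
  obtain ⟨K, hK⟩ := exists_nat_gt (2 / (1 - α))
  have h1α : 0 < 1 - α := by linarith
  have hK2 : 2 < K * (1 - α) := by rwa [div_lt_iff₀ h1α] at hK
  have hK0 : (0 : ℝ) < K := lt_trans (by positivity) hK
  have hK1 : (1 : ℝ) ≤ K := by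
    have : 0 < K := by exact_mod_cast hK0
    exact_mod_cast this
  let y : ℕ → ℝ := fun n => α * n + Real.logb 2 (n + K)
  have hy0 : ∀ n, 0 ≤ y n := by
    intro n
    have : 0 ≤ Real.logb 2 (n + K) := Real.logb_nonneg (by norm_num) (by
      have : (0 : ℝ) ≤ n := by positivity
      linarith)
    simp only [y]; positivity
  have hstep : ∀ n, y n ≤ y (n + 1) ∧ y (n + 1) ≤ y n + 1 := by
    intro n
    have hn : (0 : ℝ) ≤ n := by positivity
    have h1 : Real.logb 2 (n + K) ≤ Real.logb 2 ((n + 1 : ℕ) + K) := by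
      apply Real.logb_le_logb_of_le (by norm_num) (by positivity); push_cast; linarith
    have h2 : Real.logb 2 ((n + 1 : ℕ) + K) - Real.logb 2 (n + K) ≤ 1 - α := by
      unfold Real.logb
      rw [← sub_div, div_le_iff₀ (Real.log_pos (by norm_num)), ← Real.log_div (by positivity) (by positivity)]
      have h3 := Real.log_le_sub_one_of_pos (x := (((n + 1 : ℕ) : ℝ) + K) / (n + K)) (by positivity)
      have h4 : (((n + 1 : ℕ) : ℝ) + K) / (n + K) - 1 = 1 / (n + K) := by
        push_cast; field_simp; ring
      have h5 : 1 / ((n : ℝ) + K) ≤ (1 - α) / 2 := by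
        rw [div_le_div_iff₀ (by positivity) (by norm_num)]
        nlinarith
      have := Real.log_two_gt_d9
      nlinarith
    simp only [y]
    push_cast at h1 h2 ⊢
    constructor <;> nlinarith
  let m' : ℕ → ℕ := fun n => ⌊y n⌋₊
  have hm' : ∀ n, m' (n + 1) = m' n ∨ m' (n + 1) = m' n + 1 := by
    intro n
    have h1 : m' n ≤ m' (n + 1) := Nat.floor_le_floor (hstep n).1
    have h2 : m' (n + 1) ≤ m' n + 1 := by
      rw [← Nat.floor_add_one (hy0 n)]
      exact Nat.floor_le_floor (hstep n).2
    omega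
  have hmono : ∀ n, m' 0 ≤ m' n := by
    intro n
    induction n with
    | zero => exact le_rfl
    | succ n ih => rcases hm' n with h | h <;> omega
  have hT : ∀ n : ℕ, (2 : ℝ) ^ (y n) = 2 ^ (α * n) * (n + K) := by
    intro n
    simp only [y]
    rw [Real.rpow_add (by norm_num), Real.rpow_logb (by norm_num) (by norm_num) (by positivity)]
  have hpow : ∀ n, (2 : ℝ) ^ (m' n - m' 0) * 2 ^ m' 0 = 2 ^ m' n := by
    intro n
    rw [← pow_add, Nat.sub_add_cancel (hmono n)]
  have hup : ∀ n : ℕ, (2 : ℝ) ^ m' n ≤ 2 ^ (α * n) * (n + K) := by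
    intro n
    rw [← hT, ← Real.rpow_natCast]
    exact Real.rpow_le_rpow_of_exponent_le (by norm_num) (Nat.floor_le (hy0 n))
  have hlo : ∀ n : ℕ, (2 : ℝ) ^ (α * n) * (n + K) ≤ 2 * (2 : ℝ) ^ m' n := by
    intro n
    rw [← hT, ← pow_succ', ← Real.rpow_natCast]
    apply Real.rpow_le_rpow_of_exponent_le (by norm_num)
    push_cast
    exact (Nat.lt_floor_add_one (y n)).le
  refine ⟨fun n => m' n - m' 0, 1 / (2 * 2 ^ m' 0), K, by positivity, hK0, by simp, ?_, ?_⟩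
  · intro n
    have := hmono n
    have h2 := hm' n
    show m' (n + 1) - m' 0 = m' n - m' 0 ∨ m' (n + 1) - m' 0 = m' n - m' 0 + 1
    omega
  · intro n
    have hn : (0 : ℝ) ≤ n := by positivity
    have hp : (0 : ℝ) < 2 ^ (α * n) := by positivity
    have hp0 : (1 : ℝ) ≤ 2 ^ m' 0 := one_le_pow₀ (by norm_num)
    have hpp : (0 : ℝ) < 2 ^ (m' n - m' 0) := by positivity
    have h1 := hup n
    have h2 := hlo n
    rw [← hpow n] at h1 h2
    constructor
    · rw [div_mul_eq_mul_div, one_mul, div_le_iff₀ (by positivity)]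
      have : (2 : ℝ) ^ (α * n) * (n + 1) ≤ 2 ^ (α * n) * (n + K) := by gcongr
      linarith
    · have h3 : (2 : ℝ) ^ (α * n) * (n + K) ≤ 2 ^ (α * n) * (K * (n + 1)) := by
        gcongr; nlinarith
      nlinarith

end SalemAux

namespace SalemAux

def Good (m : ℕ → ℕ) (G : ℕ → ℕ → ℕ) : Prop := G 0 0 = 0 ∧ ∀ n,
    (m (n + 1) = m n → ∃ ε : ℕ → Bool, (∀ j, G (n + 1) j = 2 * G n j + (ε j).toNat) ∧
      ∀ k : ℕ, k ≤ 256 ^ n → ‖∑ j ∈ Finset.range (2 ^ m n), (sg (ε j) : ℂ) *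
        ee (Real.sqrt k * ((G n j : ℝ) / 2 ^ n))‖ ≤ 3 * Real.sqrt (2 ^ m n * (6 * (n + 1)))) ∧
    (m (n + 1) ≠ m n → ∀ j, G (n + 1) j = 2 * G n (j / 2) + j % 2)

noncomputable def ss (m : ℕ → ℕ) (G : ℕ → ℕ → ℕ) (n : ℕ) (ξ : ℝ) : ℂ :=
  (∑ j ∈ Finset.range (2 ^ m n), ee (ξ * ((G n j : ℝ) / 2 ^ n))) / 2 ^ m n

noncomputable def uu (n : ℕ) (ξ : ℝ) : ℂ :=
  (1 - ee (ξ / 2 ^ n)) * 2 ^ n / (2 * (Real.pi : ℂ) * Complex.I * (ξ : ℂ))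

lemma norm_den (ξ : ℝ) (hξ : 0 < ξ) :
    ‖2 * (Real.pi : ℂ) * Complex.I * (ξ : ℂ)‖ = 2 * Real.pi * ξ := by
  simp [abs_of_pos hξ, abs_of_pos Real.pi_pos]

lemma norm_uu_le_one (n : ℕ) (ξ : ℝ) (hξ : 0 < ξ) : ‖uu n ξ‖ ≤ 1 := by
  unfold uu
  have hpi := Real.pi_pos
  rw [norm_div, norm_den ξ hξ, div_le_one (by positivity), norm_mul, norm_sub_rev]
  have := norm_ee_sub_one (ξ / 2 ^ n)
  rw [abs_of_pos (by positivity)] at this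
  calc _ ≤ (2 * Real.pi * (ξ / 2 ^ n)) * ‖(2 : ℂ) ^ n‖ := by gcongr
    _ = _ := by simp; field_simp

lemma norm_uu_le (n : ℕ) (ξ : ℝ) (hξ : 0 < ξ) : ‖uu n ξ‖ ≤ 2 ^ n / (2 * ξ) := by
  unfold uu
  have hpi := Real.pi_gt_three
  rw [norm_div, norm_den ξ hξ, norm_mul]
  have h1 : ‖1 - ee (ξ / 2 ^ n)‖ ≤ 2 := by
    refine (norm_sub_le _ _).trans ?_
    rw [norm_ee]; norm_num
  have h2 : ‖(2 : ℂ) ^ n‖ = 2 ^ n := by simp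
  rw [h2, div_le_div_iff₀ (by positivity) (by positivity)]
  have : (0 : ℝ) < 2 ^ n * ξ := by positivity
  calc ‖1 - ee (ξ / 2 ^ n)‖ * 2 ^ n * (2 * ξ) ≤ 2 * 2 ^ n * (2 * ξ) := by gcongr
    _ ≤ 2 ^ n * (2 * Real.pi * ξ) := by nlinarith

lemma ee_half (n : ℕ) (ξ : ℝ) : ee (ξ / 2 ^ n) = ee (ξ / 2 ^ (n + 1)) ^ 2 := by
  rw [sq, ← ee_add]; congr 1; rw [pow_succ]; field_simp; norm_num

lemma uu_rec (n : ℕ) (ξ : ℝ) : uu n ξ = uu (n + 1) ξ * ((1 + ee (ξ / 2 ^ (n + 1))) / 2) := by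
  unfold uu
  rw [ee_half, pow_succ]; ring

lemma sum_range_two_mul (N : ℕ) (g : ℕ → ℂ) :
    ∑ j ∈ Finset.range (2 * N), g j = ∑ j ∈ Finset.range N, (g (2 * j) + g (2 * j + 1)) := by
  induction N with
  | zero => simp
  | succ N ih =>
    rw [show 2 * (N + 1) = 2 * N + 1 + 1 by ring, Finset.sum_range_succ, Finset.sum_range_succ, ih,
      Finset.sum_range_succ]; ring

lemma ee_child (n : ℕ) (ξ : ℝ) (g d : ℕ) :
    ee (ξ * (((2 * g + d : ℕ) : ℝ) / 2 ^ (n + 1))) =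
      ee (ξ * ((g : ℝ) / 2 ^ n)) * ee (ξ / 2 ^ (n + 1) * d) := by
  rw [← ee_add]; congr 1; push_cast; rw [pow_succ]; field_simp

lemma step_free {m : ℕ → ℕ} {G : ℕ → ℕ → ℕ} (n : ℕ) (ξ : ℝ) (hm : m (n + 1) = m n + 1)
    (hG : ∀ j, G (n + 1) j = 2 * G n (j / 2) + j % 2) :
    ss m G (n + 1) ξ * uu (n + 1) ξ = ss m G n ξ * uu n ξ := by
  rw [uu_rec n]
  unfold ss
  rw [hm, pow_succ', sum_range_two_mul]
  have h : ∀ j, ee (ξ * ((G (n + 1) (2 * j) : ℝ) / 2 ^ (n + 1))) +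
      ee (ξ * ((G (n + 1) (2 * j + 1) : ℝ) / 2 ^ (n + 1))) =
      ee (ξ * ((G n j : ℝ) / 2 ^ n)) * (1 + ee (ξ / 2 ^ (n + 1))) := by
    intro j
    rw [hG, hG, ee_child, ee_child]
    have h1 : 2 * j / 2 = j := by omega
    have h2 : (2 * j + 1) / 2 = j := by omega
    have h3 : 2 * j % 2 = 0 := by omega
    have h4 : (2 * j + 1) % 2 = 1 := by omega
    rw [h1, h2, h3, h4]
    simp [ee_zero]; ring
  simp only [h]
  rw [← Finset.sum_mul]
  field_simp
  ring

lemma step_sgn {m : ℕ → ℕ} {G : ℕ → ℕ → ℕ} (n : ℕ) (ξ : ℝ) (hm : m (n + 1) = m n)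
    (ε : ℕ → Bool) (hG : ∀ j, G (n + 1) j = 2 * G n j + (ε j).toNat) :
    ss m G (n + 1) ξ * uu (n + 1) ξ - ss m G n ξ * uu n ξ =
    (∑ j ∈ Finset.range (2 ^ m n), (sg (ε j) : ℂ) * ee (ξ * ((G n j : ℝ) / 2 ^ n))) / 2 ^ m n *
      (uu (n + 1) ξ * ((1 - ee (ξ / 2 ^ (n + 1))) / 2)) := by
  rw [uu_rec n]
  unfold ss
  rw [hm]
  have h : ∀ j, ee (ξ * ((G (n + 1) j : ℝ) / 2 ^ (n + 1))) =
      ee (ξ * ((G n j : ℝ) / 2 ^ n)) * ((1 + ee (ξ / 2 ^ (n + 1))) / 2) +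
      (sg (ε j) : ℂ) * ee (ξ * ((G n j : ℝ) / 2 ^ n)) * ((1 - ee (ξ / 2 ^ (n + 1))) / 2) := by
    intro j
    rw [hG, ee_child]
    cases ε j <;> simp [ee_zero, sg] <;> ring
  simp only [h]
  rw [Finset.sum_add_distrib, ← Finset.sum_mul, ← Finset.sum_mul]
  ring

lemma step_bound {m : ℕ → ℕ} {G : ℕ → ℕ → ℕ} (hG : Good m G) {α c₁ : ℝ} (hc₁ : 0 < c₁)
    (hm : ∀ n, m (n + 1) = m n ∨ m (n + 1) = m n + 1)
    (hm1 : ∀ n : ℕ, c₁ * ((2 : ℝ) ^ (α * n) * (n + 1)) ≤ 2 ^ m n) (n k : ℕ) (hk : 1 ≤ k) :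
    ‖ss m G (n + 1) (√k) * uu (n + 1) (√k) - ss m G n (√k) * uu n (√k)‖ ≤
      3 * √(6 / c₁) * (((2 : ℝ) ^ (-(α / 2))) ^ n * min 1 (2 ^ n / √k)) +
        (1 / 2) ^ n * (√k) ^ (-(1 / 2) : ℝ) := by
  have hk' : (1 : ℝ) ≤ k := by exact_mod_cast hk
  have hξ1 : 1 ≤ √(k : ℝ) := Real.one_le_sqrt.mpr hk'
  set ξ := √(k : ℝ) with hξ
  have hξ0 : 0 < ξ := by linarith
  rcases hm n with h | h
  swap
  · rw [step_free n ξ h ((hG.2 n).2 (by omega)), sub_self, norm_zero]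
    positivity
  obtain ⟨ε, h1, h2⟩ := (hG.2 n).1 h
  rw [step_sgn n ξ h ε h1, norm_mul]
  have hw : ‖uu (n + 1) ξ * ((1 - ee (ξ / 2 ^ (n + 1))) / 2)‖ ≤ min 1 (2 ^ n / ξ) := by
    have ha : ‖(1 - ee (ξ / 2 ^ (n + 1))) / 2‖ ≤ 1 := by
      rw [norm_div]
      have : ‖1 - ee (ξ / 2 ^ (n + 1))‖ ≤ 2 := by
        refine (norm_sub_le _ _).trans ?_
        rw [norm_ee]; norm_num
      simp; linarith
    have hb : ‖uu (n + 1) ξ‖ ≤ min 1 (2 ^ n / ξ) := by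
      apply le_min (norm_uu_le_one _ _ hξ0)
      refine (norm_uu_le _ _ hξ0).trans (le_of_eq ?_)
      rw [pow_succ]; field_simp
    rw [norm_mul]
    calc _ ≤ ‖uu (n + 1) ξ‖ * 1 := by gcongr
      _ ≤ _ := by rw [mul_one]; exact hb
  have hmin : 0 ≤ min 1 (2 ^ n / ξ) := by positivity
  rw [norm_div]
  have hN : ‖(2 : ℂ) ^ m n‖ = 2 ^ m n := by simp
  rw [hN]
  by_cases hkn : k ≤ 256 ^ n
  · have h3 := h2 k hkn
    have h4 : ‖∑ j ∈ Finset.range (2 ^ m n), (sg (ε j) : ℂ) * ee (ξ * ((G n j : ℝ) / 2 ^ n))‖ / 2 ^ m n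
        ≤ 3 * √(6 / c₁) * ((2 : ℝ) ^ (-(α / 2))) ^ n := by
      rw [div_le_iff₀ (by positivity)]
      refine h3.trans ?_
      have h5 : ((2 : ℝ) ^ (-(α / 2))) ^ n = √((2 : ℝ) ^ (-(α * n))) := by
        rw [Real.sqrt_eq_rpow, ← Real.rpow_natCast, ← Real.rpow_mul (by norm_num),
          ← Real.rpow_mul (by norm_num)]
        congr 1; ring
      have h6 : (2 : ℝ) ^ m n = √((2 ^ m n) * 2 ^ m n) := by
        rw [Real.sqrt_mul_self (by positivity)]
      rw [h5, mul_assoc, mul_assoc]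
      gcongr
      rw [h6, ← Real.sqrt_mul (by positivity), ← Real.sqrt_mul (by positivity)]
      rw [Real.sqrt_mul_self (by positivity)]
      apply Real.sqrt_le_sqrt
      have h7 := hm1 n
      have h8 : (2 : ℝ) ^ (α * n) * 2 ^ (-(α * n)) = 1 := by
        rw [← Real.rpow_add (by norm_num)]; simp
      have h9 : (n : ℝ) + 1 ≤ 1 / c₁ * (2 ^ (-(α * n)) * 2 ^ m n) := by
        rw [div_mul_eq_mul_div, one_mul, le_div_iff₀ hc₁]
        calc ((n : ℝ) + 1) * c₁ = 2 ^ (-(α * n)) * (c₁ * ((2 : ℝ) ^ (α * n) * (n + 1))) := by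
              linear_combination (-(n + 1) * c₁) * h8
          _ ≤ _ := by gcongr
      calc (2 : ℝ) ^ m n * (6 * (n + 1)) ≤ 2 ^ m n * (6 * (1 / c₁ * (2 ^ (-(α * n)) * 2 ^ m n))) := by
            gcongr
        _ = _ := by ring
    calc _ ≤ (3 * √(6 / c₁) * ((2 : ℝ) ^ (-(α / 2))) ^ n) * min 1 (2 ^ n / ξ) := by gcongr
      _ ≤ _ := by
        rw [mul_assoc]
        have : 0 ≤ (1 / 2 : ℝ) ^ n * ξ ^ (-(1 / 2) : ℝ) := by positivity
        linarith
  · have h4 : ‖∑ j ∈ Finset.range (2 ^ m n), (sg (ε j) : ℂ) * ee (ξ * ((G n j : ℝ) / 2 ^ n))‖ / 2 ^ m n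
        ≤ 1 := by
      rw [div_le_one (by positivity)]
      refine (norm_sum_le _ _).trans ?_
      calc _ ≤ ∑ j ∈ Finset.range (2 ^ m n), (1 : ℝ) := by
            apply Finset.sum_le_sum
            intro j _
            rw [norm_mul, norm_ee]
            cases ε j <;> simp [sg]
        _ = _ := by simp
    have h5 : (4 : ℝ) ^ n ≤ ξ ^ (1 / 2 : ℝ) := by
      rw [← Real.sqrt_eq_rpow]
      apply Real.le_sqrt_of_sq_le
      rw [hξ]
      apply Real.le_sqrt_of_sq_le
      push Not at hkn
      rw [← pow_mul, ← pow_mul]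
      have : (256 : ℝ) ^ n ≤ k := by exact_mod_cast hkn.le
      calc (4 : ℝ) ^ (n * (2 * 2)) = 256 ^ n := by
            rw [mul_comm, pow_mul]; norm_num
        _ ≤ _ := this
    have h6 : 2 ^ n / ξ ≤ (1 / 2) ^ n * ξ ^ (-(1 / 2) : ℝ) := by
      rw [Real.rpow_neg hξ0.le]
      have h7 : ξ = ξ ^ (1 / 2 : ℝ) * ξ ^ (1 / 2 : ℝ) := by
        rw [← Real.rpow_add hξ0]; norm_num
      set r := ξ ^ (1 / 2 : ℝ)
      have hr : 0 < r := by positivity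
      rw [h7, div_pow, one_pow, ← one_div, div_mul_div_comm, one_mul, div_le_div_iff₀ (by positivity) (by positivity)]
      have h8 : (2 : ℝ) ^ n * 2 ^ n = 4 ^ n := by rw [← mul_pow]; norm_num
      calc (2 : ℝ) ^ n * (2 ^ n * r) = 4 ^ n * r := by rw [← h8]; ring
        _ ≤ r * r := by gcongr
        _ = _ := by ring
    calc _ ≤ 1 * min 1 (2 ^ n / ξ) := by gcongr
      _ ≤ 2 ^ n / ξ := by rw [one_mul]; exact min_le_right _ _
      _ ≤ _ := h6
      _ ≤ _ := by
        have : 0 ≤ 3 * √(6 / c₁) * (((2 : ℝ) ^ (-(α / 2))) ^ n * min 1 (2 ^ n / ξ)) := by positivity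
        linarith

lemma sum_bound (s : ℝ) (hs0 : 0 < s) (hs1 : s < 1 / 2) : ∃ C : ℝ, 0 < C ∧ ∀ (n : ℕ) (ξ : ℝ),
    1 ≤ ξ → ∑ i ∈ Finset.range n, (((2 : ℝ) ^ (-s)) ^ i * min 1 (2 ^ i / ξ)) ≤ C * ξ ^ (-s) := by
  set q : ℝ := (2 : ℝ) ^ (-s) with hq
  have hq0 : 0 < q := by positivity
  have hq1 : q < 1 := Real.rpow_lt_one_of_one_lt_of_neg (by norm_num) (by linarith)
  have hq2 : 1 < 2 * q := by
    have : 2 * q = 2 ^ (1 - s) := by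
      rw [hq, sub_eq_add_neg, Real.rpow_add (by norm_num), Real.rpow_one]
    rw [this]
    exact Real.one_lt_rpow (by norm_num) (by linarith)
  set A := 1 / (1 - q) with hA
  set D := 1 / (2 * q - 1) with hD
  have hA0 : 0 < A := by rw [hA]; apply one_div_pos.mpr; linarith
  have hD0 : 0 < D := by rw [hD]; apply one_div_pos.mpr; linarith
  have hD1 : D * (2 * q - 1) = 1 := by rw [hD]; apply one_div_mul_cancel; linarith
  have main : ∀ (n : ℕ) (ξ : ℝ), 1 / 2 ≤ ξ →
      ∑ i ∈ Finset.range n, (q ^ i * min 1 (2 ^ i / ξ)) ≤ (A + 2 * D) * ξ ^ (-s) - D * ξ⁻¹ := by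
    intro n
    induction n with
    | zero =>
      intro ξ hξ
      have hξ0 : 0 < ξ := by linarith
      simp only [Finset.range_zero, Finset.sum_empty]
      have h1 : ξ⁻¹ ≤ 2 * ξ ^ (-s) := by
        by_cases h : ξ ≤ 1
        · have h2 : 1 ≤ ξ ^ (-s) := Real.one_le_rpow_of_pos_of_le_one_of_nonpos hξ0 h (by linarith)
          have h3 : ξ⁻¹ ≤ 2 := by rw [inv_le_comm₀ hξ0 (by norm_num)]; linarith
          linarith
        · push Not at h
          have h2 : ξ⁻¹ ≤ ξ ^ (-s) := by
            rw [← Real.rpow_neg_one]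
            exact Real.rpow_le_rpow_of_exponent_le h.le (by linarith)
          have : 0 < ξ ^ (-s) := by positivity
          linarith
      have : 0 < ξ ^ (-s) := by positivity
      nlinarith
    | succ n ih =>
      intro ξ hξ
      have hξ0 : 0 < ξ := by linarith
      by_cases h : ξ ≤ 1
      · have h2 : 1 ≤ ξ ^ (-s) := Real.one_le_rpow_of_pos_of_le_one_of_nonpos hξ0 h (by linarith)
        have h3 : ξ⁻¹ ≤ 2 := by rw [inv_le_comm₀ hξ0 (by norm_num)]; linarith
        have h4 : ∑ i ∈ Finset.range (n + 1), (q ^ i * min 1 (2 ^ i / ξ)) ≤ A := by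
          calc _ ≤ ∑ i ∈ Finset.range (n + 1), q ^ i := by
                apply Finset.sum_le_sum
                intro i _
                exact mul_le_of_le_one_right (by positivity) (min_le_left _ _)
            _ ≤ ∑' i, q ^ i := (summable_geometric_of_lt_one hq0.le hq1).sum_le_tsum _
                  (fun i _ => by positivity)
            _ = A := by rw [tsum_geometric_of_lt_one hq0.le hq1, hA, one_div]
        nlinarith
      · push Not at h
        have ih' := ih (ξ / 2) (by linarith)
        rw [Finset.sum_range_succ']
        have h1 : ∀ i, q ^ (i + 1) * min 1 (2 ^ (i + 1) / ξ) = q * (q ^ i * min 1 (2 ^ i / (ξ / 2))) := by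
          intro i
          rw [show (2 : ℝ) ^ (i + 1) / ξ = 2 ^ i / (ξ / 2) by rw [pow_succ]; field_simp]
          ring
        simp only [h1]
        rw [← Finset.mul_sum]
        have h2 : q * (ξ / 2) ^ (-s) = ξ ^ (-s) := by
          rw [hq, ← Real.mul_rpow (by norm_num) (by positivity)]; congr 1; ring
        have h3 : (ξ / 2)⁻¹ = 2 * ξ⁻¹ := by field_simp
        have h4 : min 1 (2 ^ 0 / ξ) ≤ ξ⁻¹ := by
          refine (min_le_right _ _).trans ?_
          simp
        rw [pow_zero, one_mul]
        rw [h3] at ih'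
        calc _ ≤ q * ((A + 2 * D) * (ξ / 2) ^ (-s) - D * (2 * ξ⁻¹)) + ξ⁻¹ := by gcongr
          _ = _ := by linear_combination (A + 2 * D) * h2 - ξ⁻¹ * hD1
  refine ⟨A + 2 * D, by positivity, fun n ξ hξ => (main n ξ (by linarith)).trans ?_⟩
  have : 0 < D * ξ⁻¹ := by positivity
  linarith

lemma fourier_bound {m : ℕ → ℕ} {G : ℕ → ℕ → ℕ} (hG : Good m G) {α c₁ : ℝ} (hα0 : 0 < α) (hα1 : α < 1)
    (hc₁ : 0 < c₁) (hm0 : m 0 = 0)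
    (hm : ∀ n, m (n + 1) = m n ∨ m (n + 1) = m n + 1)
    (hm1 : ∀ n : ℕ, c₁ * ((2 : ℝ) ^ (α * n) * (n + 1)) ≤ 2 ^ m n) :
    ∃ C : ℝ, 0 < C ∧ ∀ n k : ℕ, 1 ≤ k →
      ‖ss m G n (√k) * uu n (√k)‖ ≤ C * (√k) ^ (-(α / 2)) := by
  obtain ⟨C, hC, hsum⟩ := sum_bound (α / 2) (by linarith) (by linarith)
  refine ⟨3 * √(6 / c₁) * C + 3, by positivity, fun n k hk => ?_⟩
  have hk' : (1 : ℝ) ≤ k := by exact_mod_cast hk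
  have hξ1 : 1 ≤ √(k : ℝ) := Real.one_le_sqrt.mpr hk'
  have hB := fun n => step_bound hG hc₁ hm hm1 n k hk
  set ξ := √(k : ℝ) with hξ
  have hξ0 : 0 < ξ := by linarith
  have hhalf : ξ ^ (-(1 / 2) : ℝ) ≤ ξ ^ (-(α / 2)) :=
    Real.rpow_le_rpow_of_exponent_le hξ1 (by linarith)
  have h0 : ‖ss m G 0 ξ * uu 0 ξ‖ ≤ ξ ^ (-(1 / 2) : ℝ) := by
    have h1 : ‖ss m G 0 ξ‖ = 1 := by
      unfold ss; simp [hm0, norm_ee]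
    rw [norm_mul, h1, one_mul]
    have h2 := norm_uu_le 0 ξ hξ0
    have h3 : ξ⁻¹ ≤ ξ ^ (-(1 / 2) : ℝ) := by
      rw [← Real.rpow_neg_one]
      exact Real.rpow_le_rpow_of_exponent_le hξ1 (by norm_num)
    have h4 : (2 : ℝ) ^ 0 / (2 * ξ) ≤ ξ⁻¹ := by
      rw [pow_zero, one_div]
      apply inv_anti₀ hξ0; linarith
    linarith
  have htel : ‖ss m G n ξ * uu n ξ‖ ≤ ξ ^ (-(1 / 2) : ℝ) + ∑ i ∈ Finset.range n,
      (3 * √(6 / c₁) * (((2 : ℝ) ^ (-(α / 2))) ^ i * min 1 (2 ^ i / ξ)) +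
        (1 / 2) ^ i * ξ ^ (-(1 / 2) : ℝ)) := by
    clear hsum
    induction n with
    | zero => simpa using h0
    | succ n ih =>
      rw [Finset.sum_range_succ]
      have h1 := hB n
      have h2 := norm_sub_norm_le (ss m G (n + 1) ξ * uu (n + 1) ξ) (ss m G n ξ * uu n ξ)
      linarith
  rw [Finset.sum_add_distrib, ← Finset.mul_sum, ← Finset.sum_mul] at htel
  have h1 := hsum n ξ hξ1
  have h2 : ∑ i ∈ Finset.range n, (1 / 2 : ℝ) ^ i ≤ 2 :=
    (summable_geometric_two.sum_le_tsum _ (fun i _ => by positivity)).trans tsum_geometric_two.le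
  have h3 : 0 < ξ ^ (-(1 / 2) : ℝ) := by positivity
  calc _ ≤ _ := htel
    _ ≤ ξ ^ (-(1 / 2) : ℝ) + (3 * √(6 / c₁) * (C * ξ ^ (-(α / 2))) + 2 * ξ ^ (-(1 / 2) : ℝ)) := by
      gcongr
    _ ≤ _ := by nlinarith

lemma tendsto_uu (ξ : ℝ) (hξ : 0 < ξ) :
    Filter.Tendsto (fun n => uu n ξ) Filter.atTop (nhds 1) := by
  have hd : HasDerivAt (fun z : ℂ => Complex.exp z) 1 0 := by
    simpa using Complex.hasDerivAt_exp 0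
  have h1 := hd.tendsto_slope_zero
  set w : ℕ → ℂ := fun n => -(2 * (Real.pi : ℂ) * Complex.I * ((ξ / 2 ^ n : ℝ) : ℂ)) with hw
  have hpi : (Real.pi : ℂ) ≠ 0 := by exact_mod_cast Real.pi_ne_zero
  have hξc : (ξ : ℂ) ≠ 0 := by exact_mod_cast hξ.ne'
  have hw0 : ∀ n, w n ≠ 0 := by
    intro n
    simp [hw, hξ.ne']
  have hwt : Filter.Tendsto w Filter.atTop (nhdsWithin 0 {0}ᶜ) := by
    apply tendsto_nhdsWithin_of_tendsto_nhds_of_eventually_within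
    · have h2 : Filter.Tendsto (fun n : ℕ => ξ / 2 ^ n) Filter.atTop (nhds 0) :=
        Filter.Tendsto.const_div_atTop (tendsto_pow_atTop_atTop_of_one_lt (by norm_num)) ξ
      have h3 : Continuous (fun x : ℝ => -(2 * (Real.pi : ℂ) * Complex.I * (x : ℂ))) := by fun_prop
      have h4 := (h3.tendsto 0).comp h2
      have h5 : -(2 * (Real.pi : ℂ) * Complex.I * ((0 : ℝ) : ℂ)) = 0 := by simp
      rw [h5] at h4
      exact h4
    · exact Filter.Eventually.of_forall hw0
  have h2 := h1.comp hwt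
  refine h2.congr (fun n => ?_)
  simp only [Function.comp, zero_add, Complex.exp_zero, smul_eq_mul]
  unfold uu ee
  simp only [hw]
  push_cast
  field_simp
  ring

end SalemAux

namespace SalemAux

noncomputable def xx (m : ℕ → ℕ) (G : ℕ → ℕ → ℕ) (n : ℕ) (t : ℝ) : ℝ :=
  (G n ⌊2 ^ m n * t⌋₊ : ℝ) / 2 ^ n

lemma measurable_xx (m : ℕ → ℕ) (G : ℕ → ℕ → ℕ) (n : ℕ) : Measurable (xx m G n) := by
  unfold xx
  have h1 : Measurable (fun t : ℝ => ⌊2 ^ m n * t⌋₊) := Nat.measurable_floor.comp (by fun_prop)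
  have h2 : Measurable (fun j : ℕ => (G n j : ℝ) / 2 ^ n) := Measurable.of_discrete
  exact h2.comp h1

lemma xx_step {m : ℕ → ℕ} {G : ℕ → ℕ → ℕ} (hG : Good m G)
    (hm : ∀ n, m (n + 1) = m n ∨ m (n + 1) = m n + 1) (n : ℕ) (t : ℝ) :
    xx m G n t ≤ xx m G (n + 1) t ∧ xx m G (n + 1) t + 1 / 2 ^ (n + 1) ≤ xx m G n t + 1 / 2 ^ n := by
  have key : ∃ d : ℕ, d ≤ 1 ∧ G (n + 1) ⌊2 ^ m (n + 1) * t⌋₊ = 2 * G n ⌊2 ^ m n * t⌋₊ + d := by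
    rcases hm n with h | h
    · obtain ⟨ε, h1, -⟩ := (hG.2 n).1 h
      exact ⟨_, Bool.toNat_le _, by rw [h1, h]⟩
    · refine ⟨⌊2 ^ m (n + 1) * t⌋₊ % 2, by omega, ?_⟩
      rw [(hG.2 n).2 (by omega)]
      have h2 := Nat.floor_div_natCast (2 ^ m (n + 1) * t) 2
      rw [← h2, h]
      congr 4
      push_cast; rw [pow_succ]; ring
  obtain ⟨d, hd, h⟩ := key
  have hd' : (d : ℝ) ≤ 1 := by exact_mod_cast hd
  unfold xx
  rw [h, pow_succ]
  push_cast
  have h1 : (2 * (G n ⌊2 ^ m n * t⌋₊ : ℝ) + d) / (2 ^ n * 2) =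
    (G n ⌊2 ^ m n * t⌋₊ : ℝ) / 2 ^ n + d / (2 ^ n * 2) := by field_simp
  have h2 : (1 : ℝ) / 2 ^ n = 1 / (2 ^ n * 2) + 1 / (2 ^ n * 2) := by field_simp; norm_num
  have h3 : (d : ℝ) / (2 ^ n * 2) ≤ 1 / (2 ^ n * 2) := by gcongr
  have h4 : 0 ≤ (d : ℝ) / (2 ^ n * 2) := by positivity
  rw [h1, h2]
  constructor <;> linarith

lemma exists_phi {m : ℕ → ℕ} {G : ℕ → ℕ → ℕ} (hG : Good m G)
    (hm : ∀ n, m (n + 1) = m n ∨ m (n + 1) = m n + 1) :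
    ∃ φ : ℝ → ℝ, Measurable φ ∧ ∀ n t, xx m G n t ≤ φ t ∧ φ t ≤ xx m G n t + 1 / 2 ^ n := by
  have hmono : ∀ t, Monotone (fun n => xx m G n t) := fun t =>
    monotone_nat_of_le_succ (fun n => (xx_step hG hm n t).1)
  have hanti : ∀ t, Antitone (fun n => xx m G n t + 1 / 2 ^ n) := fun t =>
    antitone_nat_of_succ_le (fun n => (xx_step hG hm n t).2)
  have hle : ∀ t n k, xx m G k t ≤ xx m G n t + 1 / 2 ^ n := by
    intro t n k
    have h1 := hmono t (le_max_left k n)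
    have h2 := hanti t (le_max_right k n)
    have h3 : (0 : ℝ) ≤ 1 / 2 ^ (max k n) := by positivity
    simp only at h1 h2
    linarith
  have hb : ∀ t, BddAbove (Set.range (fun n => xx m G n t)) := by
    intro t
    refine ⟨xx m G 0 t + 1 / 2 ^ 0, ?_⟩
    rintro _ ⟨k, rfl⟩
    exact hle t 0 k
  refine ⟨fun t => ⨆ n, xx m G n t, ?_, fun n t => ⟨le_ciSup (hb t) n, ciSup_le (hle t n)⟩⟩
  refine measurable_of_tendsto_metrizable (measurable_xx m G) ?_
  rw [tendsto_pi_nhds]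
  intro t
  exact tendsto_atTop_ciSup (hmono t) (hb t)

lemma G_inj {m : ℕ → ℕ} {G : ℕ → ℕ → ℕ} (hG : Good m G) (hm0 : m 0 = 0)
    (hm : ∀ n, m (n + 1) = m n ∨ m (n + 1) = m n + 1) (n : ℕ) :
    ∀ j k, j < 2 ^ m n → k < 2 ^ m n → G n j = G n k → j = k := by
  induction n with
  | zero => intro j k hj hk _; rw [hm0] at hj hk; omega
  | succ n ih =>
    intro j k hj hk h
    rcases hm n with h1 | h1
    · obtain ⟨ε, h2, -⟩ := (hG.2 n).1 h1
      rw [h2, h2] at h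
      rw [h1] at hj hk
      have := Bool.toNat_le (ε j)
      have := Bool.toNat_le (ε k)
      exact ih j k hj hk (by omega)
    · have h2 := (hG.2 n).2 (by omega)
      rw [h2, h2] at h
      rw [h1, pow_succ] at hj hk
      have := ih (j / 2) (k / 2) (by omega) (by omega) (by omega)
      omega

lemma cell (M j : ℕ) (t : ℝ) (ht : 0 ≤ t) :
    ⌊2 ^ M * t⌋₊ = j ↔ t ∈ Set.Ico ((j : ℝ) / 2 ^ M) ((j + 1 : ℝ) / 2 ^ M) := by
  rw [Nat.floor_eq_iff (by positivity), Set.mem_Ico, div_le_iff₀ (by positivity),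
    lt_div_iff₀ (by positivity), mul_comm]

lemma floor_lt (M : ℕ) (t : ℝ) (ht : t ∈ Set.Ico (0 : ℝ) 1) : ⌊2 ^ M * t⌋₊ < 2 ^ M := by
  rw [Nat.floor_lt (by have := ht.1; positivity)]
  push_cast
  have : (0 : ℝ) < 2 ^ M := by positivity
  nlinarith [ht.2]

lemma vol_cell (M j : ℕ) :
    volume (Set.Ico ((j : ℝ) / 2 ^ M) ((j + 1 : ℝ) / 2 ^ M)) = ENNReal.ofReal (1 / 2 ^ M) := by
  rw [Real.volume_Ico]; congr 1; ring

lemma vol_le {m : ℕ → ℕ} {G : ℕ → ℕ → ℕ} (hG : Good m G) (hm0 : m 0 = 0)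
    (hm : ∀ n, m (n + 1) = m n ∨ m (n + 1) = m n + 1) (n i : ℕ) :
    volume (Set.Ico (0 : ℝ) 1 ∩ {t | G n ⌊2 ^ m n * t⌋₊ = i}) ≤ ENNReal.ofReal (1 / 2 ^ m n) := by
  rcases (Set.Ico (0 : ℝ) 1 ∩ {t | G n ⌊2 ^ m n * t⌋₊ = i}).eq_empty_or_nonempty with h | ⟨t₀, h0, h1⟩
  · rw [h]; simp
  · rw [← vol_cell (m n) ⌊2 ^ m n * t₀⌋₊]
    apply measure_mono
    rintro t ⟨h2, h3⟩
    rw [← cell _ _ _ h2.1]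
    exact G_inj hG hm0 hm n _ _ (floor_lt _ _ h2) (floor_lt _ _ h0) (h3.trans h1.symm)

lemma upper {m : ℕ → ℕ} {G : ℕ → ℕ → ℕ} (hG : Good m G) (hm0 : m 0 = 0)
    (hm : ∀ n, m (n + 1) = m n ∨ m (n + 1) = m n + 1) {φ : ℝ → ℝ}
    (hφ : ∀ n t, xx m G n t ≤ φ t ∧ φ t ≤ xx m G n t + 1 / 2 ^ n)
    (n : ℕ) (x r : ℝ) (hr : 2 * r ≤ 1 / 2 ^ n) :
    volume (Set.Ico (0 : ℝ) 1 ∩ φ ⁻¹' Set.Icc (x - r) (x + r)) ≤ ENNReal.ofReal (3 / 2 ^ m n) := by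
  have hp : (0 : ℝ) < 2 ^ n := by positivity
  set a : ℤ := ⌈2 ^ n * (x - r) - 1⌉ with ha
  let S : ℕ → Set ℝ := fun i => Set.Ico (0 : ℝ) 1 ∩ {t | G n ⌊2 ^ m n * t⌋₊ = i}
  have hsub : Set.Ico (0 : ℝ) 1 ∩ φ ⁻¹' Set.Icc (x - r) (x + r) ⊆
      (S a.toNat ∪ S (a + 1).toNat) ∪ S (a + 2).toNat := by
    rintro t ⟨ht, h1, h2⟩
    have h3 := hφ n t
    unfold xx at h3
    set g := G n ⌊2 ^ m n * t⌋₊ with hg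
    have h4 : (a : ℤ) ≤ g := by
      rw [ha, Int.ceil_le]
      push_cast
      have h5 : x - r ≤ (g + 1) / 2 ^ n := by rw [add_div]; linarith [h3.2]
      rw [le_div_iff₀ hp] at h5
      linarith
    have h6 : (g : ℤ) ≤ a + 2 := by
      have h5 : (g : ℝ) / 2 ^ n ≤ x + r := by linarith [h3.1]
      rw [div_le_iff₀ hp] at h5
      have h7 := Int.le_ceil (2 ^ n * (x - r) - 1)
      rw [← ha] at h7
      rw [le_div_iff₀ hp] at hr
      have : (g : ℝ) ≤ a + 2 := by linarith
      exact_mod_cast this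
    have h8 : g = a.toNat ∨ g = (a + 1).toNat ∨ g = (a + 2).toNat := by omega
    rcases h8 with h | h | h
    · exact Or.inl (Or.inl ⟨ht, h⟩)
    · exact Or.inl (Or.inr ⟨ht, h⟩)
    · exact Or.inr ⟨ht, h⟩
  have hv := fun i => vol_le hG hm0 hm n i
  calc _ ≤ volume ((S a.toNat ∪ S (a + 1).toNat) ∪ S (a + 2).toNat) := measure_mono hsub
    _ ≤ volume (S a.toNat) + volume (S (a + 1).toNat) + volume (S (a + 2).toNat) :=
      (measure_union_le _ _).trans (by gcongr; exact measure_union_le _ _)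
    _ ≤ ENNReal.ofReal (1 / 2 ^ m n) + ENNReal.ofReal (1 / 2 ^ m n) + ENNReal.ofReal (1 / 2 ^ m n) := by
      gcongr <;> exact hv _
    _ = _ := by
      rw [← ENNReal.ofReal_add (by positivity) (by positivity),
        ← ENNReal.ofReal_add (by positivity) (by positivity)]
      congr 1; ring

lemma lower {m : ℕ → ℕ} {G : ℕ → ℕ → ℕ} {φ : ℝ → ℝ}
    (hφ : ∀ n t, xx m G n t ≤ φ t ∧ φ t ≤ xx m G n t + 1 / 2 ^ n)
    (n : ℕ) (x r t₀ : ℝ) (ht₀ : t₀ ∈ Set.Ico (0 : ℝ) 1) (hx : |φ t₀ - x| ≤ r / 2)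
    (hr : 1 / 2 ^ n ≤ r / 2) :
    ENNReal.ofReal (1 / 2 ^ m n) ≤ volume (Set.Ico (0 : ℝ) 1 ∩ φ ⁻¹' Set.Icc (x - r) (x + r)) := by
  rw [← vol_cell (m n) ⌊2 ^ m n * t₀⌋₊]
  apply measure_mono
  intro t ht
  have hlt := floor_lt (m n) t₀ ht₀
  have ht0 : 0 ≤ t := le_trans (by positivity) ht.1
  have ht1 : t < 1 := by
    refine lt_of_lt_of_le ht.2 ?_
    rw [div_le_one (by positivity)]
    exact_mod_cast hlt
  have h1 := (cell _ _ _ ht0).mpr ht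
  have h2 := hφ n t
  have h3 := hφ n t₀
  have h4 : xx m G n t = xx m G n t₀ := by unfold xx; rw [h1]
  rw [h4] at h2
  rw [abs_le] at hx
  refine ⟨⟨ht0, ht1⟩, ?_, ?_⟩ <;> linarith [h2.1, h2.2, h3.1, h3.2, hx.1, hx.2]

lemma ss_eq (m : ℕ → ℕ) (G : ℕ → ℕ → ℕ) (n : ℕ) (ξ : ℝ) :
    ss m G n ξ = ∫ t in Set.Ico (0 : ℝ) 1, ee (ξ * xx m G n t) := by
  have hU : Set.Ico (0 : ℝ) 1 = ⋃ j ∈ Finset.range (2 ^ m n),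
      Set.Ico ((j : ℝ) / 2 ^ m n) ((j + 1 : ℝ) / 2 ^ m n) := by
    ext t
    simp only [Set.mem_iUnion, Finset.mem_range, exists_prop]
    constructor
    · intro ht
      exact ⟨⌊2 ^ m n * t⌋₊, floor_lt _ _ ht, (cell _ _ _ ht.1).mp rfl⟩
    · rintro ⟨j, hj, ht⟩
      refine ⟨le_trans (by positivity) ht.1, lt_of_lt_of_le ht.2 ?_⟩
      rw [div_le_one (by positivity)]
      exact_mod_cast hj
  have hc : ∀ j : ℕ, ∀ t ∈ Set.Ico ((j : ℝ) / 2 ^ m n) ((j + 1 : ℝ) / 2 ^ m n),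
      ee (ξ * xx m G n t) = ee (ξ * ((G n j : ℝ) / 2 ^ n)) := by
    intro j t ht
    have ht0 : 0 ≤ t := le_trans (by positivity) ht.1
    unfold xx
    rw [(cell _ _ _ ht0).mpr ht]
  rw [hU, integral_biUnion_finset]
  · unfold ss
    rw [Finset.sum_div]
    apply Finset.sum_congr rfl
    intro j _
    rw [setIntegral_congr_fun measurableSet_Ico (hc j), setIntegral_const, Measure.real, vol_cell,
      ENNReal.toReal_ofReal (by positivity), Complex.real_smul]
    push_cast
    ring
  · intro j _; exact measurableSet_Ico
  · intro j _ k _ hjk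
    refine Set.disjoint_left.mpr ?_
    intro t h1 h2
    have ht0 : 0 ≤ t := le_trans (by positivity) h1.1
    exact hjk (((cell _ _ _ ht0).mpr h1).symm.trans ((cell _ _ _ ht0).mpr h2))
  · intro j _
    refine IntegrableOn.congr_fun ?_ (fun t ht => (hc j t ht).symm) measurableSet_Ico
    exact integrableOn_const (by rw [vol_cell]; exact ENNReal.ofReal_ne_top)

lemma integrable_ee {φ : ℝ → ℝ} (hφ : Measurable φ) (ξ : ℝ) :
    IntegrableOn (fun t => ee (ξ * φ t)) (Set.Ico (0 : ℝ) 1) := by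
  refine Integrable.mono' (g := fun _ => (1 : ℝ)) (integrableOn_const (by simp)) ?_ ?_
  · exact (continuous_ee.measurable.comp (hφ.const_mul ξ)).aestronglyMeasurable
  · exact Filter.Eventually.of_forall (fun t => (norm_ee _).le)

lemma diff_bound {φ ψ : ℝ → ℝ} (hφ : Measurable φ) (hψ : Measurable ψ) (ξ η B : ℝ)
    (hB : ∀ t ∈ Set.Ico (0 : ℝ) 1, |ξ * φ t - η * ψ t| ≤ B) :
    ‖(∫ t in Set.Ico (0 : ℝ) 1, ee (ξ * φ t)) - ∫ t in Set.Ico (0 : ℝ) 1, ee (η * ψ t)‖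
      ≤ 2 * Real.pi * B := by
  rw [← integral_sub (integrable_ee hφ ξ) (integrable_ee hψ η)]
  have h := norm_setIntegral_le_of_norm_le_const (μ := volume) (s := Set.Ico (0 : ℝ) 1)
    (f := fun t => ee (ξ * φ t) - ee (η * ψ t)) (C := 2 * Real.pi * B) (by simp) (by
      intro t ht
      refine (norm_ee_sub _ _).trans ?_
      have := hB t ht
      have := Real.pi_pos
      gcongr)
  simpa using h

lemma tendsto_ss {m : ℕ → ℕ} {G : ℕ → ℕ → ℕ} {φ : ℝ → ℝ} (hφm : Measurable φ)
    (hφ : ∀ n t, xx m G n t ≤ φ t ∧ φ t ≤ xx m G n t + 1 / 2 ^ n) (ξ : ℝ) (hξ : 0 < ξ) :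
    Filter.Tendsto (fun n => ss m G n ξ) Filter.atTop
      (nhds (∫ t in Set.Ico (0 : ℝ) 1, ee (ξ * φ t))) := by
  rw [tendsto_iff_norm_sub_tendsto_zero]
  have h2 : Filter.Tendsto (fun n : ℕ => (2 * Real.pi * ξ) / 2 ^ n) Filter.atTop (nhds 0) :=
    Filter.Tendsto.const_div_atTop (tendsto_pow_atTop_atTop_of_one_lt (by norm_num)) _
  refine squeeze_zero (fun n => norm_nonneg _) (fun n => ?_) h2
  rw [ss_eq]
  refine (diff_bound (measurable_xx m G n) hφm ξ ξ (ξ / 2 ^ n) ?_).trans (le_of_eq (by ring))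
  intro t _
  have h := hφ n t
  rw [← mul_sub, abs_mul, abs_of_pos hξ, div_eq_mul_one_div]
  gcongr
  rw [abs_le]
  have : (0 : ℝ) ≤ 1 / 2 ^ n := by positivity
  constructor <;> linarith [h.1, h.2]

lemma decay {φ : ℝ → ℝ} (hφm : Measurable φ) (hφ01 : ∀ t ∈ Set.Ico (0 : ℝ) 1, φ t ∈ Set.Icc (0 : ℝ) 1)
    (s C : ℝ) (hs0 : 0 < s) (hs1 : s < 1) (hC : 0 < C)
    (h : ∀ k : ℕ, 1 ≤ k → ‖∫ t in Set.Ico (0 : ℝ) 1, ee (√k * φ t)‖ ≤ C * (√k) ^ (-s))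
    (ξ : ℝ) (hξ : ξ ≠ 0) :
    ‖∫ t in Set.Ico (0 : ℝ) 1, ee (ξ * φ t)‖ ≤ (2 * C + 2 * Real.pi) * |ξ| ^ (-s) := by
  have hpi := Real.pi_gt_three
  have hpos : ∀ ξ : ℝ, 0 < ξ →
      ‖∫ t in Set.Ico (0 : ℝ) 1, ee (ξ * φ t)‖ ≤ (2 * C + 2 * Real.pi) * ξ ^ (-s) := by
    intro ξ hξ
    rcases lt_or_ge ξ 1 with h1 | h1
    · have h2 : ‖∫ t in Set.Ico (0 : ℝ) 1, ee (ξ * φ t)‖ ≤ 1 := by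
        have h := norm_setIntegral_le_of_norm_le_const (μ := volume) (s := Set.Ico (0 : ℝ) 1)
          (f := fun t => ee (ξ * φ t)) (C := 1) (by simp) (fun t ht => (norm_ee _).le)
        simpa using h
      have h3 : 1 ≤ ξ ^ (-s) := Real.one_le_rpow_of_pos_of_le_one_of_nonpos hξ h1.le (by linarith)
      nlinarith
    · set k := ⌊ξ ^ 2⌋₊ with hk
      have hk1 : 1 ≤ k := Nat.le_floor (by push_cast; nlinarith)
      have hk1' : (1 : ℝ) ≤ k := by exact_mod_cast hk1
      have hk2 : (k : ℝ) ≤ ξ ^ 2 := Nat.floor_le (by positivity)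
      have hk3 : ξ ^ 2 < k + 1 := Nat.lt_floor_add_one _
      have hq : √(k : ℝ) ^ 2 = k := Real.sq_sqrt (by positivity)
      have hq1 : √(k : ℝ) ≤ ξ := by
        rw [Real.sqrt_le_left hξ.le]; exact hk2
      have hh := h k hk1
      have hq0 : 1 ≤ √(k : ℝ) := Real.one_le_sqrt.mpr hk1'
      set q := √(k : ℝ)
      have hq2 : ξ / 2 ≤ q := by nlinarith
      have hd : ξ - q ≤ ξ⁻¹ := by
        rw [← one_div, le_div_iff₀ hξ]; nlinarith
      have hdiff := diff_bound hφm hφm ξ q (ξ⁻¹) (by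
        intro t ht
        have h01 := hφ01 t ht
        rw [← sub_mul, abs_mul, abs_of_nonneg (by linarith), abs_of_nonneg h01.1]
        calc (ξ - q) * φ t ≤ (ξ - q) * 1 := by
              apply mul_le_mul_of_nonneg_left h01.2; linarith
          _ ≤ _ := by linarith)
      have h4 : ξ⁻¹ ≤ ξ ^ (-s) := by
        rw [← Real.rpow_neg_one]
        exact Real.rpow_le_rpow_of_exponent_le h1 (by linarith)
      have h5 : q ^ (-s) ≤ 2 * ξ ^ (-s) := by
        calc q ^ (-s) ≤ (ξ / 2) ^ (-s) :=
              Real.rpow_le_rpow_of_nonpos (by positivity) hq2 (by linarith)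
          _ = 2 ^ s * ξ ^ (-s) := by
              rw [Real.div_rpow hξ.le (by norm_num), Real.rpow_neg (by norm_num : (0:ℝ) ≤ 2)]
              field_simp
          _ ≤ 2 * ξ ^ (-s) := by
              gcongr
              calc (2 : ℝ) ^ s ≤ 2 ^ (1 : ℝ) :=
                    Real.rpow_le_rpow_of_exponent_le (by norm_num) hs1.le
                _ = 2 := Real.rpow_one 2
      have h6 := norm_sub_norm_le (∫ t in Set.Ico (0 : ℝ) 1, ee (ξ * φ t))
        (∫ t in Set.Ico (0 : ℝ) 1, ee (q * φ t))
      have h7 : C * q ^ (-s) ≤ C * (2 * ξ ^ (-s)) := by gcongr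
      have h8 : 2 * Real.pi * ξ⁻¹ ≤ 2 * Real.pi * ξ ^ (-s) := by gcongr
      linarith
  rcases lt_or_gt_of_ne hξ with h1 | h1
  · have h2 := hpos (-ξ) (by linarith)
    rw [abs_of_neg h1]
    refine le_trans (le_of_eq ?_) h2
    rw [← RCLike.norm_conj, ← integral_conj]
    congr 2
    ext t
    rw [ee_eq, ee_eq, ← Complex.exp_conj]
    congr 1
    simp
    exact Or.inl (map_ofNat (starRingEnd ℂ) 2)
  · rw [abs_of_pos h1]; exact hpos ξ h1

end SalemAux

namespace SalemAux

lemma scale_bounds (α c₁ c₂ : ℝ) (hα0 : 0 < α) (hα1 : α < 1) (hc₁ : 0 < c₁) (hc₂ : 0 < c₂) (m : ℕ → ℕ)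
    (hm : ∀ n : ℕ, c₁ * ((2 : ℝ) ^ (α * n) * (n + 1)) ≤ 2 ^ m n ∧
      (2 : ℝ) ^ m n ≤ c₂ * ((2 : ℝ) ^ (α * n) * (n + 1))) (r : ℝ) (hr0 : 0 < r) (hr1 : r < 1 / 4) :
    0 < Real.log (1 / (2 * r)) ∧
    ∃ n : ℕ, 2 * r ≤ 1 / 2 ^ n ∧ 1 / 2 ^ (n + 3) ≤ r / 2 ∧
      3 / 2 ^ m n ≤ 6 / c₁ * (2 * r) ^ α / Real.log (1 / (2 * r)) ∧
      1 / (80 * c₂) * (2 * r) ^ α / Real.log (1 / (2 * r)) ≤ 1 / 2 ^ m (n + 3) := by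
  obtain ⟨n, hn1, hn2⟩ := exists_nat_pow_near_of_lt_one (x := 2 * r) (y := 1 / 2) (by linarith)
    (by linarith) (by norm_num) (by norm_num)
  have hn0 : 1 ≤ n := by
    by_contra h
    have : n = 0 := by omega
    subst this
    norm_num at hn1
    linarith
  have hn0' : (1 : ℝ) ≤ n := by exact_mod_cast hn0
  rw [div_pow, one_pow] at hn1 hn2
  have h2r : 0 < 2 * r := by linarith
  set L := Real.log (1 / (2 * r)) with hL
  have hl2 := Real.log_two_gt_d9
  have hl2' := Real.log_two_lt_d9
  have hL1 : L ≤ n + 1 := by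
    have h1 : 1 / (2 * r) ≤ 2 ^ (n + 1) := by
      rw [div_le_iff₀ h2r]
      rw [div_lt_iff₀ (by positivity)] at hn1
      linarith
    have h2 := Real.log_le_log (by positivity) h1
    rw [Real.log_pow] at h2
    push_cast at h2
    nlinarith
  have hL2 : n / 2 ≤ L := by
    have h1 : (2 : ℝ) ^ n ≤ 1 / (2 * r) := by
      rw [le_div_iff₀ h2r]
      rw [le_div_iff₀ (by positivity)] at hn2
      linarith
    have h2 := Real.log_le_log (by positivity) h1
    rw [Real.log_pow] at h2
    nlinarith
  have hL0 : 0 < L := by linarith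
  have hT : (0 : ℝ) < 2 ^ (α * n) := by positivity
  have hpow : ∀ k : ℕ, ((1 : ℝ) / 2 ^ k) ^ α = 1 / 2 ^ (α * k) := by
    intro k
    rw [Real.div_rpow (by norm_num) (by positivity), Real.one_rpow, ← Real.rpow_natCast,
      ← Real.rpow_mul (by norm_num), mul_comm]
  have hr_up : (2 * r) ^ α ≤ 1 / 2 ^ (α * n) := by
    rw [← hpow]
    exact Real.rpow_le_rpow h2r.le hn2 hα0.le
  have hr_lo : 1 / (2 * 2 ^ (α * n)) ≤ (2 * r) ^ α := by
    have h1 : ((1 : ℝ) / 2 ^ (n + 1)) ^ α ≤ (2 * r) ^ α :=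
      Real.rpow_le_rpow (by positivity) hn1.le hα0.le
    rw [hpow] at h1
    refine le_trans ?_ h1
    apply one_div_le_one_div_of_le (by positivity)
    push_cast
    rw [mul_add, Real.rpow_add (by norm_num), mul_one, mul_comm]
    gcongr
    calc (2 : ℝ) ^ α ≤ 2 ^ (1 : ℝ) := Real.rpow_le_rpow_of_exponent_le (by norm_num) hα1.le
      _ = 2 := Real.rpow_one 2
  refine ⟨hL0, n, hn2, ?_, ?_, ?_⟩
  · have : (1 : ℝ) / 2 ^ (n + 3) = 1 / 2 ^ (n + 1) / 4 := by
      rw [pow_add, pow_add]; field_simp; norm_num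
    rw [this]; linarith
  · calc (3 : ℝ) / 2 ^ m n ≤ 3 / (c₁ * ((2 : ℝ) ^ (α * n) * (n + 1))) := by
          gcongr; exact (hm n).1
      _ = 6 / c₁ * (1 / (2 * 2 ^ (α * n))) / (n + 1) := by field_simp; norm_num
      _ ≤ 6 / c₁ * (2 * r) ^ α / L := by gcongr
  · have h3 := (hm (n + 3)).2
    have h4 : (2 : ℝ) ^ (α * ((n + 3 : ℕ) : ℝ)) ≤ 2 ^ (α * n) * 8 := by
      push_cast
      rw [mul_add, Real.rpow_add (by norm_num)]
      gcongr
      calc (2 : ℝ) ^ (α * 3) ≤ 2 ^ (3 : ℝ) :=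
            Real.rpow_le_rpow_of_exponent_le (by norm_num) (by linarith)
        _ = 8 := by norm_num
    have h5 : (2 : ℝ) ^ m (n + 3) ≤ c₂ * ((2 ^ (α * n) * 8) * (10 * L)) := by
      refine h3.trans ?_
      gcongr
      push_cast; linarith
    calc 1 / (80 * c₂) * (2 * r) ^ α / L ≤ 1 / (80 * c₂) * (1 / 2 ^ (α * n)) / L := by gcongr
      _ = 1 / (c₂ * ((2 ^ (α * n) * 8) * (10 * L))) := by field_simp; norm_num
      _ ≤ _ := by gcongr

end SalemAux

/-- **Theorem 2 (Chen).** For every `α ∈ (0,1)` there exist a compact set `E ⊆ ℝ`, a Borel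
probability measure `μ` supported on `E`, and constants `0 < c ≤ C < ∞` such that
`|μ̂(ξ)| ≤ C |ξ|^{-α/2}` for all `ξ ≠ 0`, and
`c (2r)^α / log(1/(2r)) ≤ μ([x-r, x+r]) ≤ C (2r)^α / log(1/(2r))`
for all `x ∈ E` and `0 < r < 1/4`. -/
theorem salem_endpoint_decay_log_regularity (α : ℝ) (hα0 : 0 < α) (hα1 : α < 1) :
    ∃ (E : Set ℝ) (μ : Measure ℝ) (c C : ℝ),
      IsCompact E ∧ IsProbabilityMeasure μ ∧ μ E = 1 ∧ 0 < c ∧ c ≤ C ∧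
      (∀ ξ : ℝ, ξ ≠ 0 →
        ‖∫ x : ℝ, Complex.exp (-(2 * (Real.pi : ℂ) * Complex.I * (ξ : ℂ) * (x : ℂ))) ∂μ‖
          ≤ C * |ξ| ^ (-(α / 2))) ∧
      (∀ x ∈ E, ∀ r : ℝ, 0 < r → r < 1 / 4 →
        c * (2 * r) ^ α / Real.log (1 / (2 * r)) ≤ (μ (Set.Icc (x - r) (x + r))).toReal ∧
        (μ (Set.Icc (x - r) (x + r))).toReal ≤ C * (2 * r) ^ α / Real.log (1 / (2 * r))) := by
  
  obtain ⟨m, c₁, c₂, hc₁, hc₂, hm0, hm, hmb⟩ := SalemAux.exists_m α hα0 hα1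
  obtain ⟨G, hG'⟩ := SalemAux.exists_data m
  have hG : SalemAux.Good m G := hG'
  clear hG'
  obtain ⟨φ, hφm, hφ⟩ := SalemAux.exists_phi hG hm
  obtain ⟨C, hC, hF⟩ := SalemAux.fourier_bound hG hα0 hα1 hc₁ hm0 hm (fun n => (hmb n).1)
  have hφ01 : ∀ t ∈ Set.Ico (0 : ℝ) 1, φ t ∈ Set.Icc (0 : ℝ) 1 := by
    intro t ht
    have h1 := hφ 0 t
    have h2 : SalemAux.xx m G 0 t = 0 := by
      unfold SalemAux.xx
      have h3 := SalemAux.floor_lt (m 0) t ht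
      have h4 : ⌊2 ^ m 0 * t⌋₊ = 0 := by rw [hm0] at h3 ⊢; omega
      rw [h4, hG.1]; simp
    rw [h2] at h1
    simpa using h1
  have hlim : ∀ k : ℕ, 1 ≤ k →
      ‖∫ t in Set.Ico (0 : ℝ) 1, SalemAux.ee (√k * φ t)‖ ≤ C * (√k) ^ (-(α / 2)) := by
    intro k hk
    have hpos : 0 < √(k : ℝ) := Real.sqrt_pos.mpr (by exact_mod_cast hk)
    have h1 := ((SalemAux.tendsto_ss hφm hφ (√k) hpos).mul (SalemAux.tendsto_uu (√k) hpos)).norm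
    rw [mul_one] at h1
    exact le_of_tendsto h1 (Filter.Eventually.of_forall (fun n => hF n k hk))
  have hdecay := SalemAux.decay hφm hφ01 (α / 2) C (by linarith) (by linarith) hC hlim
  set E : Set ℝ := closure (φ '' Set.Ico (0 : ℝ) 1) with hE
  set μ : Measure ℝ := (volume.restrict (Set.Ico (0 : ℝ) 1)).map φ with hμ
  have hμS : ∀ S : Set ℝ, MeasurableSet S → μ S = volume (Set.Ico (0 : ℝ) 1 ∩ φ ⁻¹' S) := by
    intro S hS
    rw [hμ, Measure.map_apply hφm hS, Measure.restrict_apply (hφm hS), Set.inter_comm]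
  have hprob : IsProbabilityMeasure μ := ⟨by rw [hμS _ MeasurableSet.univ]; simp⟩
  refine ⟨E, μ, 1 / (80 * c₂), max (1 / (80 * c₂)) (max (6 / c₁) (2 * C + 2 * Real.pi)),
    ?_, hprob, ?_, by positivity, le_max_left _ _, ?_, ?_⟩
  · apply Metric.isCompact_of_isClosed_isBounded isClosed_closure
    apply Bornology.IsBounded.closure
    refine (Metric.isBounded_Icc (0 : ℝ) 1).subset ?_
    rintro _ ⟨t, ht, rfl⟩
    exact hφ01 t ht
  · rw [hμS _ isClosed_closure.measurableSet]
    have : Set.Ico (0 : ℝ) 1 ∩ φ ⁻¹' E = Set.Ico (0 : ℝ) 1 := by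
      apply Set.inter_eq_left.mpr
      intro t ht
      exact subset_closure ⟨t, ht, rfl⟩
    rw [this]; simp
  · intro ξ hξ
    have h1 : ∀ x : ℝ, Complex.exp (-(2 * (Real.pi : ℂ) * Complex.I * (ξ : ℂ) * (x : ℂ))) =
        SalemAux.ee (ξ * x) := by
      intro x
      unfold SalemAux.ee
      congr 1; push_cast; ring
    simp only [h1]
    have hcont : Continuous (fun x : ℝ => SalemAux.ee (ξ * x)) :=
      SalemAux.continuous_ee.comp (by fun_prop)
    rw [hμ, integral_map hφm.aemeasurable hcont.aestronglyMeasurable]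
    refine (hdecay ξ hξ).trans ?_
    gcongr
    exact (le_max_right _ _).trans (le_max_right _ _)
  · intro x hx r hr0 hr1
    obtain ⟨hL, n, hn1, hn2, hup, hlo⟩ :=
      SalemAux.scale_bounds α c₁ c₂ hα0 hα1 hc₁ hc₂ m hmb r hr0 hr1
    rw [hμS _ measurableSet_Icc]
    have hU := SalemAux.upper hG hm0 hm hφ n x r hn1
    obtain ⟨_, ⟨t₀, ht₀, rfl⟩, hxt⟩ := Metric.mem_closure_iff.mp hx (r / 2) (by linarith)
    rw [dist_comm, Real.dist_eq] at hxt
    have hLo := SalemAux.lower hφ (n + 3) x r t₀ ht₀ hxt.le hn2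
    constructor
    · refine hlo.trans ?_
      rw [← ENNReal.ofReal_le_iff_le_toReal (ne_top_of_le_ne_top ENNReal.ofReal_ne_top hU)]
      exact hLo
    · refine (ENNReal.toReal_le_of_le_ofReal (by positivity) hU).trans (hup.trans ?_)
      gcongr
      exact (le_max_left _ _).trans (le_max_right _ _)
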